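/- arXiv:2010.12946 — 2 statements merged into one kernel-verified Lean document; each statement's English description precedes it below -/
import Mathlib

section
/- Let d ≥ 1, let f : ℝ^d → ℝ be continuously differentiable, let x_1, …, x_N ∈ [0,1]^d, and let W ≥ 0 be an ∞-transport bound for the pair (μ_N, Lebesgue measure restricted to [0,1]^d), where μ_N = (1/N)∑_{k=1}^N δ_{x_k}. Then there is a constant c_d > 0 depending only on d such that |∫_{[0,1]^d} f(x) dx − (1/N)∑_{k=1}^N f(x_k)| ≤ c_d · ‖∇f‖_{L^∞([0,1]^d)}^{(d−1)/d} · ‖∇f‖_{L^1([0,1]^d)}^{1/d} · N^{1/d} · W². -/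
open MeasureTheory Metric
open scoped ENNReal

noncomputable section

/-- The closed unit cube `[0,1]^d` in `ℝ^d`. -/
def unitCube (d : ℕ) : Set (EuclideanSpace ℝ (Fin d)) :=
  {x | ∀ i, x i ∈ Set.Icc (0 : ℝ) 1}

/-- The empirical measure `(1/N) ∑ δ_{x k}`. -/
def empiricalMeasure (d N : ℕ) (x : Fin N → EuclideanSpace ℝ (Fin d)) :
    Measure (EuclideanSpace ℝ (Fin d)) :=
  ((N : ℝ≥0∞))⁻¹ • ∑ k, MeasureTheory.Measure.dirac (x k)

/-- `W` is an `∞`-transport bound for `(μ, ν)`: there is a coupling of `μ` and `ν`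
which moves no mass further than `W`. -/
def IsInfTransportBound {d : ℕ} (μ ν : Measure (EuclideanSpace ℝ (Fin d))) (W : ℝ) : Prop :=
  ∃ π : Measure (EuclideanSpace ℝ (Fin d) × EuclideanSpace ℝ (Fin d)),
    π.map Prod.fst = μ ∧ π.map Prod.snd = ν ∧ π {p | W < dist p.1 p.2} = 0


abbrev EE (d : ℕ) := EuclideanSpace ℝ (Fin d)

lemma measurableSet_unitCube (d : ℕ) : MeasurableSet (unitCube d) := by
  have : unitCube d = ⋂ i, {x : EE d | x i ∈ Set.Icc (0:ℝ) 1} := by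
    ext x; simp [unitCube]
  rw [this]
  exact MeasurableSet.iInter fun i => measurableSet_Icc.preimage (by fun_prop)

lemma convex_unitCube (d : ℕ) : Convex ℝ (unitCube d) := by
  intro x hx y hy a b ha hb hab i
  have := convex_Icc (0:ℝ) 1 (hx i) (hy i) ha hb hab
  simpa using this

lemma isCompact_unitCube (d : ℕ) : IsCompact (unitCube d) := by
  have : unitCube d = (EuclideanSpace.equiv (Fin d) ℝ).symm '' (Set.univ.pi fun _ => Set.Icc (0:ℝ) 1) := by
    ext x
    constructor
    · intro h
      exact ⟨EuclideanSpace.equiv (Fin d) ℝ x, fun i _ => h i, by simp⟩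
    · rintro ⟨y, hy, rfl⟩ i
      exact hy i trivial
  rw [this]
  exact (isCompact_univ_pi fun _ => isCompact_Icc).image (EuclideanSpace.equiv (Fin d) ℝ).symm.continuous

lemma mem_cube_ray {d : ℕ} {x y : EE d} (hx : x ∈ unitCube d) (hy : y ∈ unitCube d) {t : ℝ}
    (h0 : 0 ≤ t) (h1 : t ≤ 1) : x + t • (y - x) ∈ unitCube d :=
  (convex_unitCube d).add_smul_sub_mem hx hy ⟨h0, h1⟩

/-- The measure of balls for the empirical measure is controlled by volume. -/
lemma emp_ball {d : ℕ} {μ : Measure (EE d)} {W : ℝ} (hW : 0 ≤ W)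
    (π : Measure (EE d × EE d)) (h1 : π.map Prod.fst = μ)
    (h2 : π.map Prod.snd = volume.restrict (unitCube d))
    (h3 : π {p | W < dist p.1 p.2} = 0) (z : EE d) :
    μ (closedBall z W) ≤ ENNReal.ofReal ((2 * W) ^ d) * volume (ball (0 : EE d) 1) := by
  have e : volume (closedBall z (2 * W)) =
      ENNReal.ofReal ((2 * W) ^ d) * volume (ball (0 : EE d) 1) := by
    rw [Measure.addHaar_closedBall _ _ (by positivity)]; simp
  rw [← e]
  calc μ (closedBall z W) = π (Prod.fst ⁻¹' closedBall z W) := by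
        rw [← h1, Measure.map_apply measurable_fst measurableSet_closedBall]
    _ ≤ π (Prod.snd ⁻¹' closedBall z (2 * W) ∪ {p | W < dist p.1 p.2}) := by
        refine measure_mono ?_
        intro p hp
        by_cases hq : W < dist p.1 p.2
        · exact Or.inr hq
        · left
          simp only [Set.mem_preimage, mem_closedBall] at hp ⊢
          have := dist_triangle_left p.2 z p.1
          linarith
    _ ≤ π (Prod.snd ⁻¹' closedBall z (2 * W)) + 0 := by
        rw [← h3]; exact measure_union_le _ _
    _ = (volume.restrict (unitCube d)) (closedBall z (2 * W)) := by
        rw [add_zero, ← h2, Measure.map_apply measurable_snd measurableSet_closedBall]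
    _ ≤ _ := Measure.restrict_apply_le _ _

lemma emp_lintegral {d N : ℕ} (x : Fin N → EE d) (h : EE d → ℝ≥0∞) (hh : Measurable h) :
    ∫⁻ y, h y ∂(empiricalMeasure d N x) = (N : ℝ≥0∞)⁻¹ * ∑ k, h (x k) := by
  simp [empiricalMeasure, lintegral_dirac' _ hh]

lemma ae_pi {d N : ℕ} {x : Fin N → EE d} {W : ℝ} 
    (π : Measure (EE d × EE d)) (h1 : π.map Prod.fst = empiricalMeasure d N x)
    (h2 : π.map Prod.snd = volume.restrict (unitCube d))
    (h3 : π {p | W < dist p.1 p.2} = 0) :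
    ∀ᵐ p ∂π, (∃ k, p.1 = x k) ∧ p.2 ∈ unitCube d ∧ dist p.1 p.2 ≤ W := by
  have a1 : ∀ᵐ y ∂(π.map Prod.fst), ∃ k, y = x k := by
    rw [h1, ae_iff]
    have hm : MeasurableSet {a : EE d | ¬ ∃ k, a = x k} := by
      have : {a : EE d | ¬ ∃ k, a = x k} = (Set.range x)ᶜ := by
        ext a; simp [eq_comm]
      rw [this]
      exact (Set.finite_range x).measurableSet.compl
    simp only [empiricalMeasure, Measure.smul_apply, Measure.finsetSum_apply]
    rw [Finset.sum_eq_zero]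
    · simp
    · intro k _
      rw [Measure.dirac_apply' _ hm]
      simp
  have a2 : ∀ᵐ y ∂(π.map Prod.snd), y ∈ unitCube d := by
    rw [h2]; exact ae_restrict_mem (measurableSet_unitCube d)
  have b1 := ae_of_ae_map measurable_fst.aemeasurable a1
  have b2 := ae_of_ae_map measurable_snd.aemeasurable a2
  have b3 : ∀ᵐ p ∂π, ¬ (W < dist p.1 p.2) := by
    rw [ae_iff]; simpa using h3
  filter_upwards [b1, b2, b3] with p q1 q2 q3
  exact ⟨q1, q2, not_lt.1 q3⟩

/-- Weighted count of sample points near a given point. -/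
lemma sum_ball {d N : ℕ} (hN : 0 < N) {x : Fin N → EE d} {W : ℝ} (hW : 0 ≤ W)
    (π : Measure (EE d × EE d)) (h1 : π.map Prod.fst = empiricalMeasure d N x)
    (h2 : π.map Prod.snd = volume.restrict (unitCube d))
    (h3 : π {p | W < dist p.1 p.2} = 0) (G : EE d → ℝ≥0∞) (hG : Measurable G) :
    ∑ k, ∫⁻ z in unitCube d, (closedBall (x k) W).indicator G z ≤
      (N : ℝ≥0∞) * (ENNReal.ofReal ((2 * W) ^ d) * volume (ball (0 : EE d) 1)) *
        ∫⁻ z in unitCube d, G z := by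
  rw [← lintegral_finsetSum _ (fun k _ => hG.indicator measurableSet_closedBall),
    ← lintegral_const_mul _ hG]
  refine lintegral_mono fun z => ?_
  have hb := emp_ball hW π h1 h2 h3 z
  have e : empiricalMeasure d N x (closedBall z W) =
      (N : ℝ≥0∞)⁻¹ * ∑ k, (closedBall z W).indicator 1 (x k) := by
    rw [← emp_lintegral x _ (measurable_one.indicator measurableSet_closedBall),
      lintegral_indicator_one measurableSet_closedBall]
  rw [e, ENNReal.inv_mul_le_iff (by simpa using hN.ne') (by simp)] at hb
  calc ∑ k, (closedBall (x k) W).indicator G z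
      = (∑ k, (closedBall z W).indicator 1 (x k)) * G z := by
        rw [Finset.sum_mul]
        refine Finset.sum_congr rfl fun k _ => ?_
        by_cases h : dist z (x k) ≤ W
        · have h' : dist (x k) z ≤ W := by rwa [dist_comm]
          simp [Set.indicator, h, h']
        · have h' : ¬ dist (x k) z ≤ W := by rwa [dist_comm]
          simp [Set.indicator, h, h']
    _ ≤ _ := by gcongr

lemma ray_bound {d N : ℕ} (hN : 0 < N) {x : Fin N → EE d} (hx : ∀ k, x k ∈ unitCube d)
    {W : ℝ} (hW : 0 ≤ W)
    (π : Measure (EE d × EE d)) (h1 : π.map Prod.fst = empiricalMeasure d N x)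
    (h2 : π.map Prod.snd = volume.restrict (unitCube d))
    (h3 : π {p | W < dist p.1 p.2} = 0) (G : EE d → ℝ≥0∞) (hG : Measurable G)
    {t : ℝ} (t0 : 0 < t) (t1 : t ≤ 1) :
    ∫⁻ p, G (p.1 + t • (p.2 - p.1)) ∂π ≤
      ENNReal.ofReal ((t ^ d)⁻¹) *
      ((N : ℝ≥0∞) * (ENNReal.ofReal ((2 * W) ^ d) * volume (ball (0 : EE d) 1)) *
        ∫⁻ z in unitCube d, G z) := by
  classical
  let H : Fin N → EE d → ℝ≥0∞ := fun k =>
    (unitCube d ∩ closedBall (x k) W).indicator G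
  have hms : ∀ k, MeasurableSet (unitCube d ∩ closedBall (x k) W) := fun k =>
    (measurableSet_unitCube d).inter measurableSet_closedBall
  have hH : ∀ k, Measurable (H k) := fun k => hG.indicator (hms k)
  calc ∫⁻ p, G (p.1 + t • (p.2 - p.1)) ∂π
      ≤ ∫⁻ p, ∑ k, H k (x k + t • (p.2 - x k)) ∂π := by
        refine lintegral_mono_ae ?_
        filter_upwards [ae_pi π h1 h2 h3] with p hp
        obtain ⟨⟨k, hk⟩, hc, hdist⟩ := hp
        refine le_trans ?_ (Finset.single_le_sum (fun i _ => zero_le) (Finset.mem_univ k))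
        rw [← hk]
        have : p.1 + t • (p.2 - p.1) ∈ unitCube d ∩ closedBall (x k) W := by
          refine ⟨mem_cube_ray (hk ▸ hx k) hc t0.le t1, ?_⟩
          rw [← hk, mem_closedBall, dist_eq_norm, add_sub_cancel_left, norm_smul,
            Real.norm_of_nonneg t0.le, ← dist_eq_norm, dist_comm]
          have := dist_nonneg (x := p.1) (y := p.2)
          nlinarith
        simp only [H]
        rw [Set.indicator_of_mem this]
    _ = ∑ k, ∫⁻ p, H k (x k + t • (p.2 - x k)) ∂π := by
        rw [lintegral_finsetSum]
        intro k _
        exact (hH k).comp (by fun_prop)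
    _ = ∑ k, ∫⁻ y in unitCube d, H k (x k + t • (y - x k)) := by
        refine Finset.sum_congr rfl fun k _ => ?_
        have hm : Measurable fun y : EE d => H k (x k + t • (y - x k)) :=
          (hH k).comp (by fun_prop)
        rw [← h2, lintegral_map hm measurable_snd]
    _ ≤ ∑ k, ∫⁻ y, H k (x k + t • (y - x k)) := by
        gcongr with k; exact Measure.restrict_le_self
    _ = ∑ k, ENNReal.ofReal ((t ^ d)⁻¹) * ∫⁻ y, H k y := by
        refine Finset.sum_congr rfl fun k _ => ?_
        rw [lintegral_sub_right_eq_self (fun y => H k (x k + t • y)) (x k)]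
        have e := Measure.map_addHaar_smul (volume : Measure (EE d)) t0.ne'
        have e2 : ∫⁻ y, H k (x k + t • y) =
            ∫⁻ w, H k (x k + w) ∂(Measure.map (t • ·) volume) := by
          have hm : Measurable fun y : EE d => H k (x k + y) := (hH k).comp (by fun_prop)
          rw [lintegral_map hm (measurable_const_smul t)]
        rw [e2, e, lintegral_smul_measure, lintegral_add_left_eq_self (H k) (x k)]
        simp [abs_of_pos t0]
    _ = ENNReal.ofReal ((t ^ d)⁻¹) * ∑ k, ∫⁻ z in unitCube d, (closedBall (x k) W).indicator G z := by
        rw [Finset.mul_sum]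
        refine Finset.sum_congr rfl fun k _ => ?_
        congr 1
        rw [← lintegral_indicator (measurableSet_unitCube d)]
        simp only [H, Set.indicator_indicator]
    _ ≤ _ := by
        gcongr
        exact sum_ball hN hW π h1 h2 h3 G hG

lemma isProb_pi {d N : ℕ} (hN : 0 < N) {x : Fin N → EE d}
    (π : Measure (EE d × EE d)) (h1 : π.map Prod.fst = empiricalMeasure d N x) :
    π Set.univ = 1 := by
  have : π Set.univ = (π.map Prod.fst) Set.univ := by
    rw [Measure.map_apply measurable_fst MeasurableSet.univ, Set.preimage_univ]
  rw [this, h1]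
  have hN' : (N : ℝ≥0∞) ≠ 0 := by simpa using hN.ne'
  simp [empiricalMeasure, ENNReal.inv_mul_cancel hN' (by simp)]

lemma error_le {d N : ℕ} (hN : 0 < N) {x : Fin N → EE d}
    (π : Measure (EE d × EE d)) (h1 : π.map Prod.fst = empiricalMeasure d N x)
    (h2 : π.map Prod.snd = volume.restrict (unitCube d))
    {f : EE d → ℝ} (hf : Continuous f) :
    ENNReal.ofReal |(∫ y in unitCube d, f y) - (1 / N : ℝ) * ∑ k, f (x k)| ≤
      ∫⁻ p, ‖f p.2 - f p.1‖ₑ ∂π := by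
  have i2 : Integrable f (π.map Prod.snd) := by
    rw [h2]
    exact hf.continuousOn.integrableOn_compact (isCompact_unitCube d)
  have i1 : Integrable f (π.map Prod.fst) := by
    rw [h1]
    refine Integrable.smul_measure ?_ (by simpa using hN.ne')
    rw [integrable_finsetSum_measure]
    intro k _
    exact integrable_dirac (by simp)
  have e2 : ∫ y in unitCube d, f y = ∫ p, f p.2 ∂π := by
    rw [← h2, integral_map measurable_snd.aemeasurable i2.aestronglyMeasurable]
  have e1 : (1 / N : ℝ) * ∑ k, f (x k) = ∫ p, f p.1 ∂π := by
    rw [← integral_map (φ := Prod.fst) measurable_fst.aemeasurable i1.aestronglyMeasurable, h1, empiricalMeasure,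
      integral_smul_measure, integral_finsetSum_measure]
    · simp
    · intro k _
      exact integrable_dirac (by simp)
  have j2 : Integrable (fun p : EE d × EE d => f p.2) π := i2.comp_measurable measurable_snd
  have j1 : Integrable (fun p : EE d × EE d => f p.1) π := i1.comp_measurable measurable_fst
  rw [e1, e2, ← integral_sub j2 j1,
    ← Real.norm_eq_abs, ofReal_norm]
  exact enorm_integral_le_lintegral_enorm _

lemma ray_ftc {d : ℕ} {f : EE d → ℝ} (hf : ContDiff ℝ 1 f) (x y : EE d) {a : ℝ} (ha : a ≤ 1) :
    ‖f y - f (x + a • (y - x))‖ₑ ≤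
      ‖y - x‖ₑ * ∫⁻ t in Set.Ioc a 1, ‖fderiv ℝ f (x + t • (y - x))‖ₑ := by
  have hfc : Continuous (fderiv ℝ f) := hf.continuous_fderiv (by norm_num)
  have hd : ∀ t : ℝ, HasDerivAt (fun t : ℝ => f (x + t • (y - x)))
      (fderiv ℝ f (x + t • (y - x)) (y - x)) t := by
    intro t
    have h := (hf.differentiable (by norm_num) (x + t • (y - x))).hasFDerivAt
    have h' : HasDerivAt (fun t : ℝ => x + t • (y - x)) (y - x) t := by
      simpa using ((hasDerivAt_id t).smul_const (y - x)).const_add x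
    exact h.comp_hasDerivAt t h'
  have hc : Continuous fun t : ℝ => fderiv ℝ f (x + t • (y - x)) (y - x) :=
    (hfc.comp (by fun_prop)).clm_apply continuous_const
  have e := intervalIntegral.integral_eq_sub_of_hasDerivAt (a := a) (b := 1) (fun t _ => hd t)
    (hc.intervalIntegrable _ _)
  simp only [one_smul, add_sub_cancel] at e
  rw [← e, intervalIntegral.integral_of_le ha]
  refine (enorm_integral_le_lintegral_enorm _).trans ?_
  rw [← lintegral_const_mul]
  · refine lintegral_mono fun t => ?_
    rw [mul_comm]
    exact ContinuousLinearMap.le_opENorm _ _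
  · exact (hfc.comp (by fun_prop)).enorm.measurable

lemma lint_pow {d : ℕ} (hd : 2 ≤ d) {a : ℝ} (ha : 0 < a) :
    ∫⁻ t in Set.Ioc a 1, ENNReal.ofReal ((t ^ d)⁻¹) ≤ ENNReal.ofReal (a / a ^ d) := by
  have hd' : (2:ℝ) ≤ d := by exact_mod_cast hd
  have hlt : (-(d:ℝ)) < -1 := by linarith
  have hi := integrableOn_Ioi_rpow_of_lt hlt ha
  have he := integral_Ioi_rpow_of_lt hlt ha
  calc ∫⁻ t in Set.Ioc a 1, ENNReal.ofReal ((t ^ d)⁻¹)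
      ≤ ∫⁻ t in Set.Ioi a, ENNReal.ofReal ((t ^ d)⁻¹) :=
        lintegral_mono_set Set.Ioc_subset_Ioi_self
    _ = ∫⁻ t in Set.Ioi a, ENNReal.ofReal (t ^ (-(d:ℝ))) := by
        refine setLIntegral_congr_fun measurableSet_Ioi fun t ht => ?_
        have : 0 < t := ha.trans ht
        rw [Real.rpow_neg this.le, Real.rpow_natCast]
    _ = ENNReal.ofReal (∫ t in Set.Ioi a, t ^ (-(d:ℝ))) := by
        rw [ofReal_integral_eq_lintegral_ofReal hi]
        filter_upwards [ae_restrict_mem measurableSet_Ioi] with t ht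
        exact Real.rpow_nonneg (ha.trans ht).le _
    _ ≤ _ := by
        rw [he]
        apply ENNReal.ofReal_le_ofReal
        have e : a ^ (-(d:ℝ) + 1) = a / a ^ d := by
          rw [Real.rpow_add ha, Real.rpow_neg ha.le, Real.rpow_natCast, Real.rpow_one]
          field_simp
        rw [e]
        have hp : 0 < a / a ^ d := by positivity
        have : -(a / a ^ d) / (-(d:ℝ) + 1) = (a / a ^ d) / (d - 1) := by
          rw [show -(d:ℝ) + 1 = -(d - 1) by ring, neg_div_neg_eq]
        rw [this]
        exact div_le_self hp.le (by linarith)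

lemma cube_lip {d : ℕ} {f : EE d → ℝ} (hf : ContDiff ℝ 1 f) {M : ℝ}
    (hM : ∀ z ∈ unitCube d, ‖fderiv ℝ f z‖ ≤ M) {x y : EE d} (hx : x ∈ unitCube d)
    (hy : y ∈ unitCube d) : ‖f y - f x‖ ≤ M * ‖y - x‖ :=
  (convex_unitCube d).norm_image_sub_le_of_norm_fderiv_le
    (fun z _ => hf.differentiable (by norm_num) z) hM hx hy

lemma simple_bound {d N : ℕ} (hN : 0 < N) {x : Fin N → EE d} (hx : ∀ k, x k ∈ unitCube d)
    {W : ℝ} 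
    (π : Measure (EE d × EE d)) (h1 : π.map Prod.fst = empiricalMeasure d N x)
    (h2 : π.map Prod.snd = volume.restrict (unitCube d))
    (h3 : π {p | W < dist p.1 p.2} = 0)
    {f : EE d → ℝ} (hf : ContDiff ℝ 1 f) {M : ℝ} (hM0 : 0 ≤ M)
    (hM : ∀ z ∈ unitCube d, ‖fderiv ℝ f z‖ ≤ M) :
    ∫⁻ p, ‖f p.2 - f p.1‖ₑ ∂π ≤ ENNReal.ofReal (M * W) := by
  calc ∫⁻ p, ‖f p.2 - f p.1‖ₑ ∂π ≤ ∫⁻ p, ENNReal.ofReal (M * W) ∂π := by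
        refine lintegral_mono_ae ?_
        filter_upwards [ae_pi π h1 h2 h3] with p hp
        obtain ⟨⟨k, hk⟩, hc, hdist⟩ := hp
        rw [← ofReal_norm]
        apply ENNReal.ofReal_le_ofReal
        refine (cube_lip hf hM (hk ▸ hx k) hc).trans ?_
        rw [← dist_eq_norm, dist_comm]
        gcongr
    _ = _ := by rw [lintegral_const, isProb_pi hN π h1, mul_one]

lemma split_bound {d N : ℕ} (hd : 2 ≤ d) (hN : 0 < N) {x : Fin N → EE d} (hx : ∀ k, x k ∈ unitCube d)
    {W : ℝ} (hW : 0 ≤ W)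
    (π : Measure (EE d × EE d)) (h1 : π.map Prod.fst = empiricalMeasure d N x)
    (h2 : π.map Prod.snd = volume.restrict (unitCube d))
    (h3 : π {p | W < dist p.1 p.2} = 0)
    {f : EE d → ℝ} (hf : ContDiff ℝ 1 f) {M : ℝ} (hM0 : 0 ≤ M)
    (hM : ∀ z ∈ unitCube d, ‖fderiv ℝ f z‖ ≤ M) {a : ℝ} (a0 : 0 < a) (a1 : a ≤ 1) :
    ∫⁻ p, ‖f p.2 - f p.1‖ₑ ∂π ≤ ENNReal.ofReal (M * (a * W)) +
      ENNReal.ofReal W * (ENNReal.ofReal (a / a ^ d) *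
        ((N : ℝ≥0∞) * (ENNReal.ofReal ((2 * W) ^ d) * volume (ball (0 : EE d) 1)) *
        ∫⁻ z in unitCube d, ‖fderiv ℝ f z‖ₑ)) := by
  have hprob := isProb_pi hN π h1
  have : IsProbabilityMeasure π := ⟨hprob⟩
  have hfc : Continuous (fderiv ℝ f) := hf.continuous_fderiv (by norm_num)
  set A := ((N : ℝ≥0∞) * (ENNReal.ofReal ((2 * W) ^ d) * volume (ball (0 : EE d) 1)) *
        ∫⁻ z in unitCube d, ‖fderiv ℝ f z‖ₑ) with hA
  have hmeas : Measurable fun q : (EE d × EE d) × ℝ =>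
      ‖fderiv ℝ f (q.1.1 + q.2 • (q.1.2 - q.1.1))‖ₑ :=
    (hfc.comp (by fun_prop)).enorm.measurable
  calc ∫⁻ p, ‖f p.2 - f p.1‖ₑ ∂π
      ≤ ∫⁻ p, (ENNReal.ofReal (M * (a * W)) + ENNReal.ofReal W *
        ∫⁻ t in Set.Ioc a 1, ‖fderiv ℝ f (p.1 + t • (p.2 - p.1))‖ₑ) ∂π := by
        refine lintegral_mono_ae ?_
        filter_upwards [ae_pi π h1 h2 h3] with p hp
        obtain ⟨⟨k, hk⟩, hc, hdist⟩ := hp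
        have hp1 : p.1 ∈ unitCube d := hk ▸ hx k
        have hn : ‖p.2 - p.1‖ ≤ W := by rwa [← dist_eq_norm, dist_comm]
        have hs : f p.2 - f p.1 = (f (p.1 + a • (p.2 - p.1)) - f p.1) +
          (f p.2 - f (p.1 + a • (p.2 - p.1))) := by ring
        rw [hs]
        refine (enorm_add_le _ _).trans ?_
        refine add_le_add ?_ ((ray_ftc hf p.1 p.2 a1).trans ?_)
        · rw [← ofReal_norm]
          apply ENNReal.ofReal_le_ofReal
          refine (cube_lip hf hM hp1 (mem_cube_ray hp1 hc a0.le a1)).trans ?_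
          rw [add_sub_cancel_left, norm_smul, Real.norm_of_nonneg a0.le]
          gcongr
        · gcongr
          rw [← ofReal_norm]
          exact ENNReal.ofReal_le_ofReal hn
    _ = ENNReal.ofReal (M * (a * W)) + ENNReal.ofReal W *
        ∫⁻ p, (∫⁻ t in Set.Ioc a 1, ‖fderiv ℝ f (p.1 + t • (p.2 - p.1))‖ₑ) ∂π := by
        rw [lintegral_add_left measurable_const, lintegral_const, hprob, mul_one,
          lintegral_const_mul]
        exact hmeas.lintegral_prod_right'
    _ = ENNReal.ofReal (M * (a * W)) + ENNReal.ofReal W *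
        ∫⁻ t in Set.Ioc a 1, ∫⁻ p, ‖fderiv ℝ f (p.1 + t • (p.2 - p.1))‖ₑ ∂π := by
        rw [lintegral_lintegral_swap]
        exact hmeas.aemeasurable
    _ ≤ ENNReal.ofReal (M * (a * W)) + ENNReal.ofReal W *
        ∫⁻ t in Set.Ioc a 1, ENNReal.ofReal ((t ^ d)⁻¹) * A := by
        gcongr _ + _ * ?_
        refine setLIntegral_mono' measurableSet_Ioc fun t ht => ?_
        exact ray_bound hN hx hW π h1 h2 h3 (fun z => ‖fderiv ℝ f z‖ₑ) hfc.enorm.measurable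
          (a0.trans ht.1) ht.2
    _ ≤ _ := by
        gcongr _ + _ * ?_
        rw [lintegral_mul_const _ (by fun_prop)]
        gcongr
        exact lint_pow hd a0

lemma exists_iota : ∃ ι : ℝ → EE 1, MeasurePreserving ι ∧ (∀ t s, ι (t * s) = t • ι s) ∧
    (∀ s, ‖ι s‖ = |s|) ∧ Function.Surjective ι := by
  let b := OrthonormalBasis.singleton (Fin 1) ℝ
  refine ⟨b.repr, b.measurePreserving_repr, fun t s => ?_, fun s => ?_, b.repr.surjective⟩
  · exact b.repr.toLinearEquiv.map_smul t s
  · exact LinearIsometryEquiv.norm_map b.repr s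

lemma one_bound {N : ℕ} (hN : 0 < N) {x : Fin N → EE 1} (hx : ∀ k, x k ∈ unitCube 1)
    {W : ℝ} (hW : 0 ≤ W)
    (π : Measure (EE 1 × EE 1)) (h1 : π.map Prod.fst = empiricalMeasure 1 N x)
    (h2 : π.map Prod.snd = volume.restrict (unitCube 1))
    (h3 : π {p | W < dist p.1 p.2} = 0)
    {f : EE 1 → ℝ} (hf : ContDiff ℝ 1 f) :
    ∫⁻ p, ‖f p.2 - f p.1‖ₑ ∂π ≤ 
        ((ENNReal.ofReal ((2 * W) ^ 1) * volume (ball (0 : EE 1) 1)) *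
        ∫⁻ z in unitCube 1, ‖fderiv ℝ f z‖ₑ) := by
  have hfc : Continuous (fderiv ℝ f) := hf.continuous_fderiv (by norm_num)
  let Φ : EE 1 → ℝ≥0∞ := fun q => 
    ∫⁻ z in unitCube 1, (closedBall q W).indicator (fun z => ‖fderiv ℝ f z‖ₑ) z
  have key : ∀ q ∈ unitCube 1, ∀ y ∈ unitCube 1, dist q y ≤ W → ‖f y - f q‖ₑ ≤ Φ q := by
    intro q hq y hy hdist
    rcases eq_or_ne (y - q) 0 with hv | hv
    · rw [sub_eq_zero.1 hv]; simp
    obtain ⟨ι, hι, hsm, hnorm, hsurj⟩ := exists_iota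
    obtain ⟨s, hs⟩ := hsurj (y - q)
    have hns : ‖y - q‖ = |s| := by rw [← hs, hnorm]
    have hs0 : s ≠ 0 := by
      rintro rfl
      apply hv; rw [← norm_eq_zero, hns, abs_zero]
    have hms : MeasurableSet (unitCube 1 ∩ closedBall q W) :=
      (measurableSet_unitCube 1).inter measurableSet_closedBall
    let H : EE 1 → ℝ≥0∞ := (unitCube 1 ∩ closedBall q W).indicator (fun z => ‖fderiv ℝ f z‖ₑ)
    have hH : Measurable H := hfc.enorm.measurable.indicator hms
    have hH' : Measurable fun z => H (q + z) := hH.comp (by fun_prop)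
    have hHι : Measurable fun r => H (q + ι r) := hH'.comp hι.measurable
    have e0 := ray_ftc hf q y zero_le_one
    rw [zero_smul, add_zero] at e0
    refine e0.trans ?_
    have e1 : ∫⁻ t in Set.Ioc (0:ℝ) 1, ‖fderiv ℝ f (q + t • (y - q))‖ₑ ≤
        ∫⁻ t : ℝ, H (q + ι (t * s)) := by
      refine le_trans ?_ (setLIntegral_le_lintegral (Set.Ioc (0:ℝ) 1) _)
      refine setLIntegral_mono' measurableSet_Ioc fun t ht => ?_
      have e : ι (t * s) = t • (y - q) := by rw [← hs, hsm]
      rw [e]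
      have : q + t • (y - q) ∈ unitCube 1 ∩ closedBall q W := by
        refine ⟨mem_cube_ray hq hy ht.1.le ht.2, ?_⟩
        rw [mem_closedBall, dist_eq_norm, add_sub_cancel_left, norm_smul,
          Real.norm_of_nonneg ht.1.le, ← dist_eq_norm, dist_comm]
        have := dist_nonneg (x := q) (y := y)
        have := ht.2
        nlinarith
      simp only [H]
      rw [Set.indicator_of_mem this]
    have e2 : ∫⁻ t : ℝ, H (q + ι (t * s)) = ENNReal.ofReal |s⁻¹| * ∫⁻ r : ℝ, H (q + ι r) := by
      rw [← smul_eq_mul, ← lintegral_smul_measure, ← Real.map_volume_mul_right hs0,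
        lintegral_map hHι (by fun_prop)]
    have e3 : ∫⁻ r : ℝ, H (q + ι r) = ∫⁻ z, H z := by
      rw [hι.lintegral_comp hH', lintegral_add_left_eq_self H q]
    have e4 : ∫⁻ z, H z = Φ q := by
      simp only [Φ]
      rw [← lintegral_indicator (measurableSet_unitCube 1)]
      simp only [H, Set.indicator_indicator]
    rw [e2, e3, e4] at e1
    calc _ ≤ ‖y - q‖ₑ * (ENNReal.ofReal |s⁻¹| * Φ q) := by gcongr
      _ = Φ q := by
        rw [← ofReal_norm, hns, ← mul_assoc, ← ENNReal.ofReal_mul (abs_nonneg _), ← abs_mul,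
          mul_inv_cancel₀ hs0]
        simp
  have hΦ : Measurable Φ := by
    have : Measurable fun p : EE 1 × EE 1 =>
        {p : EE 1 × EE 1 | dist p.2 p.1 ≤ W}.indicator (fun p => ‖fderiv ℝ f p.2‖ₑ) p := by
      refine Measurable.indicator ?_ ?_
      · exact (hfc.comp continuous_snd).enorm.measurable
      · exact (isClosed_le (by fun_prop) (by fun_prop)).measurableSet
    exact this.lintegral_prod_right' (ν := volume.restrict (unitCube 1))
  calc ∫⁻ p, ‖f p.2 - f p.1‖ₑ ∂π ≤ ∫⁻ p, Φ p.1 ∂π := by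
        refine lintegral_mono_ae ?_
        filter_upwards [ae_pi π h1 h2 h3] with p hp
        obtain ⟨⟨k, hk⟩, hc, hdist⟩ := hp
        exact key _ (hk ▸ hx k) _ hc hdist
    _ = ∫⁻ q, Φ q ∂(empiricalMeasure 1 N x) := by
        rw [← h1, lintegral_map hΦ measurable_fst]
    _ = (N : ℝ≥0∞)⁻¹ * ∑ k, Φ (x k) := emp_lintegral x Φ hΦ
    _ ≤ _ := by
        rw [ENNReal.inv_mul_le_iff (by simpa using hN.ne') (by simp), ← mul_assoc]
        exact sum_ball hN hW π h1 h2 h3 _ hfc.enorm.measurable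

lemma opt_bound {d : ℕ} (hd : 2 ≤ d) {E M A W : ℝ} (hM : 0 ≤ M) (hA : 0 ≤ A) (hW : 0 ≤ W)
    (h1 : E ≤ M * W) (h2 : ∀ a : ℝ, 0 < a → a ≤ 1 → E ≤ M * (a * W) + W * (a / a ^ d * A)) :
    E ≤ 2 * W * (M ^ (((d : ℝ) - 1) / d) * A ^ ((1 : ℝ) / d)) := by
  have hd0 : (0:ℝ) < d := by positivity
  have hd2 : (2:ℝ) ≤ d := by exact_mod_cast hd
  have hMsplit : M = M ^ (((d : ℝ) - 1) / d) * M ^ ((1 : ℝ) / d) := by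
    rw [← Real.rpow_add_of_nonneg hM (div_nonneg (by linarith) hd0.le) (by positivity)]
    rw [show ((d : ℝ) - 1) / d + 1 / d = 1 by field_simp; ring, Real.rpow_one]
  have hnn : 0 ≤ M ^ (((d : ℝ) - 1) / d) * A ^ ((1 : ℝ) / d) := by positivity
  rcases le_or_gt M A with h | h
  · have : M ≤ M ^ (((d : ℝ) - 1) / d) * A ^ ((1 : ℝ) / d) := by
      calc M = M ^ (((d : ℝ) - 1) / d) * M ^ ((1 : ℝ) / d) := hMsplit
        _ ≤ _ := by gcongr
    nlinarith [mul_nonneg hW hnn, mul_le_mul_of_nonneg_right this hW]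
  · have hMpos : 0 < M := hA.trans_lt h
    rcases hA.eq_or_lt with h0 | h0
    · subst h0
      rw [Real.zero_rpow (by positivity), mul_zero, mul_zero]
      by_contra hE
      push Not at hE
      have hpos : 0 < M * W := hE.trans_le h1
      have := h2 (E / (M * W) / 2) (by positivity) (by
        have : E / (M * W) ≤ 1 := (div_le_one hpos).2 h1
        linarith)
      rw [mul_zero, mul_zero, add_zero] at this
      have e : M * (E / (M * W) / 2 * W) = E / 2 := by
        have hW0 : W ≠ 0 := by rintro rfl; simp at hpos
        field_simp
      linarith
    · set a := (A / M) ^ ((1 : ℝ) / d) with ha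
      have hq : 0 < A / M := by positivity
      have a0 : 0 < a := Real.rpow_pos_of_pos hq _
      have a1 : a ≤ 1 := Real.rpow_le_one hq.le ((div_le_one hMpos).2 h.le) (by positivity)
      have ad : a ^ d = A / M := by
        rw [ha, ← Real.rpow_natCast, ← Real.rpow_mul hq.le, one_div_mul_cancel hd0.ne',
          Real.rpow_one]
      have := h2 a a0 a1
      have e : a / a ^ d * A = a * M := by rw [ad]; field_simp
      have e' : M * a = M ^ (((d : ℝ) - 1) / d) * A ^ ((1 : ℝ) / d) := by
        have hMp : M ^ ((1:ℝ) / d) ≠ 0 := (Real.rpow_pos_of_pos hMpos _).ne'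
        rw [ha, Real.div_rpow hA hM]
        nth_rw 1 [hMsplit]
        field_simp
      rw [e] at this
      rw [← e']
      linarith

theorem stmt0 (d : ℕ) (hd : 1 ≤ d) :
    ∃ c : ℝ, 0 < c ∧
      ∀ (f : EuclideanSpace ℝ (Fin d) → ℝ), ContDiff ℝ 1 f →
      ∀ (N : ℕ), 0 < N →
      ∀ (x : Fin N → EuclideanSpace ℝ (Fin d)), (∀ k, x k ∈ unitCube d) →
      ∀ (W : ℝ), 0 ≤ W →
      IsInfTransportBound (empiricalMeasure d N x) (volume.restrict (unitCube d)) W →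
      |(∫ y in unitCube d, f y) - (1 / N : ℝ) * ∑ k, f (x k)| ≤
        c * (⨆ y ∈ unitCube d, ‖fderiv ℝ f y‖) ^ (((d : ℝ) - 1) / d) *
          (∫ y in unitCube d, ‖fderiv ℝ f y‖) ^ ((1 : ℝ) / d) *
          (N : ℝ) ^ ((1 : ℝ) / d) * W ^ 2 := by
  set v : ℝ := (volume (ball (0 : EE d) 1)).toReal with hv
  have hvtop : volume (ball (0 : EE d) 1) ≠ ⊤ := measure_ball_lt_top.ne
  have hv0 : 0 < v := ENNReal.toReal_pos (measure_ball_pos _ _ one_pos).ne' hvtop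
  have hvE : volume (ball (0 : EE d) 1) = ENNReal.ofReal v := (ENNReal.ofReal_toReal hvtop).symm
  refine ⟨4 * v ^ ((1:ℝ) / d) + 4 * v ^ 2, by positivity, ?_⟩
  intro f hf N hN x hx W hW ⟨π, h1, h2, h3⟩
  have hfc : Continuous (fderiv ℝ f) := hf.continuous_fderiv (by norm_num)
  set M := ⨆ y ∈ unitCube d, ‖fderiv ℝ f y‖ with hMdef
  set L := ∫ y in unitCube d, ‖fderiv ℝ f y‖ with hLdef
  have hL0 : 0 ≤ L := integral_nonneg fun _ => norm_nonneg _
  have hM0 : 0 ≤ M := Real.iSup_nonneg fun y => Real.iSup_nonneg fun _ => norm_nonneg _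
  have hM : ∀ z ∈ unitCube d, ‖fderiv ℝ f z‖ ≤ M := by
    intro z hz
    obtain ⟨B, hB⟩ := (isCompact_unitCube d).exists_bound_of_continuousOn hfc.continuousOn
    have hB0 : 0 ≤ B := (norm_nonneg _).trans (hB z hz)
    have hbdd : BddAbove (Set.range fun y => ⨆ (_ : y ∈ unitCube d), ‖fderiv ℝ f y‖) := by
      refine ⟨B, ?_⟩
      rintro _ ⟨y, rfl⟩
      exact Real.iSup_le (fun hy => hB y hy) hB0
    refine le_ciSup_of_le hbdd z ?_
    rw [ciSup_pos hz]
  have hLE : ∫⁻ z in unitCube d, ‖fderiv ℝ f z‖ₑ = ENNReal.ofReal L := by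
    rw [hLdef, ofReal_integral_norm_eq_lintegral_enorm]
    exact hfc.continuousOn.integrableOn_compact (isCompact_unitCube d)
  have herr := error_le hN π h1 h2 hf.continuous
  set E := |(∫ y in unitCube d, f y) - (1 / N : ℝ) * ∑ k, f (x k)| with hE
  have hNr : (0:ℝ) < N := by exact_mod_cast hN
  have hNE : (N : ℝ≥0∞) = ENNReal.ofReal (N : ℝ) := by simp
  rcases hd.eq_or_lt with hd1 | hd2
  · subst hd1
    have hb := herr.trans (one_bound hN hx hW π h1 h2 h3 hf)
    rw [hvE, hLE, ← ENNReal.ofReal_mul (by positivity), ← ENNReal.ofReal_mul (by positivity),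
      ENNReal.ofReal_le_ofReal_iff (by positivity)] at hb
    have hcov : 1 ≤ N * (2 * W * v) := by
      have hb := emp_ball hW π h1 h2 h3 (x ⟨0, hN⟩)
      have hge : (N : ℝ≥0∞)⁻¹ ≤ empiricalMeasure 1 N x (closedBall (x ⟨0, hN⟩) W) := by
        simp only [empiricalMeasure, Measure.smul_apply, Measure.finsetSum_apply, smul_eq_mul]
        refine le_mul_of_one_le_right' ?_
        refine le_trans ?_ (Finset.single_le_sum (fun i _ => zero_le) (Finset.mem_univ ⟨0, hN⟩))
        rw [Measure.dirac_apply_of_mem (mem_closedBall_self hW)]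
      have := hge.trans hb
      rw [hNE, ← ENNReal.ofReal_inv_of_pos hNr, hvE, ← ENNReal.ofReal_mul (by positivity),
        ENNReal.ofReal_le_ofReal_iff (by positivity), inv_le_iff_one_le_mul₀ hNr, pow_one] at this
      linarith
    simp only [Nat.cast_one, sub_self, zero_div, Real.rpow_zero, mul_one, div_one,
      Real.rpow_one, pow_one] at hb ⊢
    have hX : 0 ≤ 2 * W * v * L := by positivity
    have hY : 0 ≤ v * L * N * W ^ 2 := by positivity
    nlinarith [mul_le_mul_of_nonneg_left hcov hX]
  · have hd2 : 2 ≤ d := hd2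
    have hd0 : (0:ℝ) < d := by positivity
    set A : ℝ := N * ((2 * W) ^ d * v) * L with hA
    have hA0 : 0 ≤ A := by positivity
    have hAE : (N : ℝ≥0∞) * (ENNReal.ofReal ((2 * W) ^ d) * volume (ball (0 : EE d) 1)) *
        ∫⁻ z in unitCube d, ‖fderiv ℝ f z‖ₑ = ENNReal.ofReal A := by
      rw [hvE, hLE, hNE, ← ENNReal.ofReal_mul (by positivity), ← ENNReal.ofReal_mul (by positivity),
        ← ENNReal.ofReal_mul (by positivity)]
    have b1 : E ≤ M * W := by
      have := herr.trans (simple_bound hN hx π h1 h2 h3 hf hM0 hM)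
      rwa [ENNReal.ofReal_le_ofReal_iff (by positivity)] at this
    have b2 : ∀ a : ℝ, 0 < a → a ≤ 1 → E ≤ M * (a * W) + W * (a / a ^ d * A) := by
      intro a a0 a1
      have := herr.trans (split_bound hd2 hN hx hW π h1 h2 h3 hf hM0 hM a0 a1)
      rwa [hAE, ← ENNReal.ofReal_mul (by positivity), ← ENNReal.ofReal_mul (by positivity),
        ← ENNReal.ofReal_add (by positivity) (by positivity),
        ENNReal.ofReal_le_ofReal_iff (by positivity)] at this
    have hfin := opt_bound hd2 hM0 hA0 hW b1 b2
    have hAr : A ^ ((1:ℝ) / d) =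
        (N:ℝ) ^ ((1:ℝ) / d) * (2 * W * v ^ ((1:ℝ) / d)) * L ^ ((1:ℝ) / d) := by
      rw [hA, Real.mul_rpow (by positivity) hL0, Real.mul_rpow hNr.le (by positivity),
        Real.mul_rpow (by positivity) hv0.le, ← Real.rpow_natCast, ← Real.rpow_mul (by positivity),
        mul_one_div_cancel hd0.ne', Real.rpow_one]
    rw [hAr] at hfin
    refine hfin.trans ?_
    have hnn : 0 ≤ 4 * v ^ 2 * M ^ (((d : ℝ) - 1) / d) * L ^ ((1:ℝ) / d) *
      (N:ℝ) ^ ((1:ℝ) / d) * W ^ 2 := by positivity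
    linarith
end
end

section
/- Let d ≥ 2, R > 0, C > 0 and M ≥ 0. Let φ be a nonnegative measurable function on the sphere S_R = {x ∈ ℝ^d : ‖x‖ = R} with φ ≤ C pointwise and ∫_{S_R} φ dσ = M, where σ is the (d−1)-dimensional surface measure on S_R. Then there is a constant c_d > 0 depending only on d such that for every t > 0, the Lebesgue measure of the set {x ∈ ℝ^d : 0 < ‖x‖ ≤ R and R^{d−1} φ(R x/‖x‖) / ‖x‖^{d−1} ≥ t} is at most c_d · R · C^{1/(d−1)} · M · t^{−d/(d−1)}. Equivalently, the function x ↦ R^{d−1} φ(R x/‖x‖)/‖x‖^{d−1} on the ball of radius R has weak-L^{d/(d−1)} quasinorm at most c_d' · (R · C^{1/(d−1)} · M)^{(d−1)/d}. -/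
open MeasureTheory Metric
open scoped ENNReal
noncomputable section

/-- Radial chart of the sphere on a face of the cube. -/
def faceChart (n : ℕ) (R : ℝ) (i : Fin (n + 1)) (s : ℝ) (y : Fin n → ℝ) :
    EuclideanSpace ℝ (Fin (n + 1)) :=
  (R / ‖(WithLp.toLp 2 (i.insertNth s y) : EuclideanSpace ℝ (Fin (n + 1)))‖) •
    (WithLp.toLp 2 (i.insertNth s y) : EuclideanSpace ℝ (Fin (n + 1)))

lemma faceChart_contDiff (n : ℕ) (R : ℝ) (i : Fin (n + 1)) (s : ℝ) (hs : s ≠ 0) :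
    ContDiff ℝ 1 (faceChart n R i s) := by
  have h1 : ContDiff ℝ 1 (fun y : Fin n → ℝ =>
      (WithLp.toLp 2 (i.insertNth s y) : EuclideanSpace ℝ (Fin (n + 1)))) := by
    rw [contDiff_euclidean]
    intro j
    refine Fin.succAboveCases i ?_ (fun k => ?_) j
    · simpa using contDiff_const
    · simpa using contDiff_apply ℝ ℝ k
  have h2 : ∀ y : Fin n → ℝ,
      (WithLp.toLp 2 (i.insertNth s y) : EuclideanSpace ℝ (Fin (n + 1))) ≠ 0 := by
    intro y h
    have := congrArg (fun v : EuclideanSpace ℝ (Fin (n + 1)) => v i) h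
    simp at this
    exact hs this
  unfold faceChart
  exact (contDiff_const.div (h1.norm ℝ h2) (fun y => norm_ne_zero_iff.2 (h2 y))).smul h1

lemma sphere_subset_faces (n : ℕ) (R : ℝ) (hR : 0 < R) :
    sphere (0 : EuclideanSpace ℝ (Fin (n + 1))) R ⊆
      ⋃ i : Fin (n + 1), (faceChart n R i 1 '' closedBall 0 1 ∪
        faceChart n R i (-1) '' closedBall 0 1) := by
  intro x hx
  have hx' : ‖x‖ = R := by simpa using hx
  obtain ⟨i, -, hi⟩ := Finset.exists_max_image Finset.univ (fun j => |x j|) ⟨0, Finset.mem_univ _⟩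
  have hpos : 0 < |x i| := by
    by_contra h
    have h0 : x = 0 := by
      ext j
      have := hi j (Finset.mem_univ _)
      have : |x j| ≤ 0 := by linarith
      simpa using this
    rw [h0] at hx'
    simp at hx'
    linarith
  have key : ∀ s : ℝ, x i = s * |x i| →
      faceChart n R i s (fun k => |x i|⁻¹ * x (i.succAbove k)) = x := by
    intro s hs
    have e : (WithLp.toLp 2 (i.insertNth s (fun k => |x i|⁻¹ * x (i.succAbove k))) :
        EuclideanSpace ℝ (Fin (n + 1))) = |x i|⁻¹ • x := by
      ext j
      refine Fin.succAboveCases i ?_ (fun k => ?_) j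
      · simp
        rw [eq_inv_mul_iff_mul_eq₀ hpos.ne', mul_comm]
        exact hs.symm
      · simp
    rw [faceChart, e, norm_smul, smul_smul, hx']
    rw [norm_inv, Real.norm_eq_abs, abs_abs]
    have : R / (|x i|⁻¹ * R) * |x i|⁻¹ = 1 := by field_simp
    rw [this, one_smul]
  have hmem : (fun k => |x i|⁻¹ * x (i.succAbove k)) ∈ closedBall (0 : Fin n → ℝ) 1 := by
    rw [mem_closedBall_zero_iff, pi_norm_le_iff_of_nonneg zero_le_one]
    intro k
    rw [norm_mul, norm_inv, Real.norm_eq_abs, Real.norm_eq_abs, abs_abs, inv_mul_le_iff₀ hpos]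
    simpa using hi _ (Finset.mem_univ _)
  rw [Set.mem_iUnion]
  refine ⟨i, ?_⟩
  rcases le_total 0 (x i) with h | h
  · exact Or.inl ⟨_, hmem, key 1 (by rw [abs_of_nonneg h]; ring)⟩
  · exact Or.inr ⟨_, hmem, key (-1) (by rw [abs_of_nonpos h]; ring)⟩

lemma hausdorff_sphere_lt_top (n : ℕ) (R : ℝ) (hR : 0 < R) :
    (μH[(n : ℝ)] : Measure (EuclideanSpace ℝ (Fin (n + 1)))) (sphere 0 R) < ⊤ := by
  have face : ∀ i (s : ℝ), s ≠ 0 →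
      (μH[(n : ℝ)] : Measure (EuclideanSpace ℝ (Fin (n + 1))))
        (faceChart n R i s '' closedBall 0 1) < ⊤ := by
    intro i s hs
    obtain ⟨K, hK⟩ := (faceChart_contDiff n R i s hs).contDiffOn.exists_lipschitzOnWith (n := 1)
      (by norm_num) (convex_closedBall (0 : Fin n → ℝ) 1) (isCompact_closedBall _ _)
    refine (hK.hausdorffMeasure_image_le (Nat.cast_nonneg n)).trans_lt ?_
    have : (μH[(n : ℝ)] : Measure (Fin n → ℝ)) = volume := by
      simpa using hausdorffMeasure_pi_real (ι := Fin n)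
    rw [this]
    refine ENNReal.mul_lt_top ?_ (isCompact_closedBall _ _).measure_lt_top
    exact ENNReal.rpow_lt_top_of_nonneg (Nat.cast_nonneg n) (by simp)
  refine (measure_mono (sphere_subset_faces n R hR)).trans_lt ?_
  refine (measure_iUnion_le _).trans_lt ?_
  rw [tsum_fintype]
  refine ENNReal.sum_lt_top.2 fun i _ => ?_
  exact (measure_union_le _ _).trans_lt
    (ENNReal.add_lt_top.2 ⟨face i 1 (by norm_num), face i (-1) (by norm_num)⟩)

open Measure in
lemma cone_vol_pos (n : ℕ) (A : Set (EuclideanSpace ℝ (Fin (n + 1))))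
    (v : EuclideanSpace ℝ (Fin (n + 1))) (hv : ‖v‖ ≤ 1) (δ : ℝ) (h0 : 0 < δ) (h1 : δ ≤ 1)
    (hA : A ⊆ closedBall v δ) :
    volume (Set.image2 (fun (r : ℝ) a => r • a) (Set.Ioo (0 : ℝ) 1) A) ≤
      ENNReal.ofReal (2 ^ (n + 2) * δ ^ n) *
      volume (ball (0 : EuclideanSpace ℝ (Fin (n + 1))) 1) := by
  have hsub : Set.image2 (fun (r : ℝ) a => r • a) (Set.Ioo (0 : ℝ) 1) A ⊆
      ⋃ k ∈ Finset.range ⌈1 / δ⌉₊, closedBall (((k : ℝ) * δ) • v) (2 * δ) := by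
    rintro _ ⟨r, hr, a, ha, rfl⟩
    have hr0 : 0 ≤ r / δ := div_nonneg hr.1.le h0.le
    simp only [Set.mem_iUnion, Finset.mem_range]
    refine ⟨⌊r / δ⌋₊, ?_, ?_⟩
    · rw [Nat.floor_lt hr0]
      exact (div_lt_div_of_pos_right hr.2 h0).trans_le (Nat.le_ceil _)
    · rw [mem_closedBall, dist_eq_norm]
      have e : r • a - ((⌊r / δ⌋₊ : ℝ) * δ) • v =
          r • (a - v) + (r - (⌊r / δ⌋₊ : ℝ) * δ) • v := by module
      have f1 := Nat.floor_le hr0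
      have f2 := Nat.lt_floor_add_one (r / δ)
      rw [le_div_iff₀ h0] at f1
      rw [div_lt_iff₀ h0] at f2
      have ha' : ‖a - v‖ ≤ δ := by simpa [dist_eq_norm] using hA ha
      have g1 : ‖r • (a - v)‖ ≤ δ := by
        rw [norm_smul, Real.norm_eq_abs, abs_of_pos hr.1]
        nlinarith [norm_nonneg (a - v), hr.1, hr.2]
      have g2 : ‖(r - (⌊r / δ⌋₊ : ℝ) * δ) • v‖ ≤ δ := by
        rw [norm_smul, Real.norm_eq_abs, abs_of_nonneg (by linarith)]
        nlinarith [norm_nonneg v]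
      rw [e]
      linarith [norm_add_le (r • (a - v)) ((r - (⌊r / δ⌋₊ : ℝ) * δ) • v)]
  refine (measure_mono hsub).trans ((measure_biUnion_finset_le _ _).trans ?_)
  simp_rw [addHaar_closedBall volume _ (show 0 ≤ 2 * δ by positivity)]
  rw [Finset.sum_const, Finset.card_range, nsmul_eq_mul, ← mul_assoc]
  gcongr
  rw [← ENNReal.ofReal_natCast, ← ENNReal.ofReal_mul (Nat.cast_nonneg _)]
  apply ENNReal.ofReal_le_ofReal
  rw [finrank_euclideanSpace_fin]
  have hN : (⌈1 / δ⌉₊ : ℝ) ≤ 2 / δ := by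
    have := (Nat.ceil_lt_add_one (show 0 ≤ 1 / δ by positivity)).le
    have : 1 ≤ 1 / δ := by rw [le_div_iff₀ h0]; linarith
    have : 2 / δ = 1 / δ + 1 / δ := by ring
    linarith
  calc (⌈1 / δ⌉₊ : ℝ) * (2 * δ) ^ (n + 1) ≤ 2 / δ * (2 * δ) ^ (n + 1) := by gcongr
    _ = 2 ^ (n + 2) * δ ^ n := by field_simp; ring

open Topology in
lemma cone_vol (n : ℕ) (hn : n ≠ 0) (A : Set (EuclideanSpace ℝ (Fin (n + 1))))
    (v : EuclideanSpace ℝ (Fin (n + 1))) (hv : ‖v‖ ≤ 1) (δ : ℝ) (h0 : 0 ≤ δ) (h1 : δ ≤ 1)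
    (hA : A ⊆ closedBall v δ) :
    volume (Set.image2 (fun (r : ℝ) a => r • a) (Set.Ioo (0 : ℝ) 1) A) ≤
      ENNReal.ofReal (2 ^ (n + 2) * δ ^ n) *
      volume (ball (0 : EuclideanSpace ℝ (Fin (n + 1))) 1) := by
  rcases h0.eq_or_lt with rfl | h
  · have ht : Filter.Tendsto (fun δ : ℝ => ENNReal.ofReal (2 ^ (n + 2) * δ ^ n) *
      volume (ball (0 : EuclideanSpace ℝ (Fin (n + 1))) 1)) (𝓝[>] 0)
      (𝓝 (ENNReal.ofReal (2 ^ (n + 2) * 0 ^ n) *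
      volume (ball (0 : EuclideanSpace ℝ (Fin (n + 1))) 1))) := by
      refine ENNReal.Tendsto.mul_const (ENNReal.tendsto_ofReal ?_)
        (Or.inr measure_ball_lt_top.ne)
      exact ((by fun_prop : Continuous fun δ : ℝ => 2 ^ (n + 2) * δ ^ n).tendsto 0).mono_left
        nhdsWithin_le_nhds
    refine ge_of_tendsto ht ?_
    filter_upwards [Ioc_mem_nhdsGT (zero_lt_one (α := ℝ))] with ε hε
    exact cone_vol_pos n A v hv ε hε.1 hε.2 (hA.trans (closedBall_subset_closedBall hε.1.le))
  · exact cone_vol_pos n A v hv δ h h1 hA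

/-- The constant comparing the cone measure and the Hausdorff measure. -/
def coneConst (n : ℕ) : ℝ :=
  (n + 1) * 2 ^ (n + 2) * volume.real (ball (0 : EuclideanSpace ℝ (Fin (n + 1))) 1)

lemma coneConst_pos (n : ℕ) : 0 < coneConst n := by
  have : 0 < volume.real (ball (0 : EuclideanSpace ℝ (Fin (n + 1))) 1) :=
    ENNReal.toReal_pos (measure_ball_pos _ _ one_pos).ne' measure_ball_lt_top.ne
  unfold coneConst
  positivity

lemma toSphere_le (n : ℕ) (hn : n ≠ 0) (A : Set (sphere (0 : EuclideanSpace ℝ (Fin (n + 1))) 1))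
    (hA : MeasurableSet A) (v : sphere (0 : EuclideanSpace ℝ (Fin (n + 1))) 1)
    (δ : ℝ) (h0 : 0 ≤ δ) (h1 : δ ≤ 1) (hd : ∀ a ∈ A, dist a v ≤ δ) :
    (volume : Measure (EuclideanSpace ℝ (Fin (n + 1)))).toSphere A ≤
      ENNReal.ofReal (coneConst n * δ ^ n) := by
  rw [Measure.toSphere_apply' _ hA, finrank_euclideanSpace_fin]
  have := cone_vol n hn ((↑) '' A) v (by simp) δ h0 h1
    (by rintro _ ⟨a, ha, rfl⟩; exact hd a ha)
  rw [Set.image2_smul] at this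
  refine (mul_le_mul_right this _).trans ?_
  rw [← ENNReal.ofReal_toReal (measure_ball_lt_top (μ := volume)
    (x := (0 : EuclideanSpace ℝ (Fin (n + 1)))) (r := 1)).ne, ← ENNReal.ofReal_natCast,
    ← ENNReal.ofReal_mul (by positivity), ← ENNReal.ofReal_mul (by positivity)]
  apply ENNReal.ofReal_le_ofReal
  apply le_of_eq
  simp only [coneConst, Measure.real]
  push_cast
  ring

lemma map_toSphere_le (n : ℕ) (hn : n ≠ 0) (R : ℝ) (hR : 0 < R) :
    Measure.map (fun ω : sphere (0 : EuclideanSpace ℝ (Fin (n + 1))) 1 =>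
      R • (ω : EuclideanSpace ℝ (Fin (n + 1)))) (volume.toSphere) ≤
      ENNReal.ofReal (coneConst n / R ^ n) •
        (μH[(n : ℝ)] : Measure (EuclideanSpace ℝ (Fin (n + 1)))) := by
  set k := ENNReal.ofReal (coneConst n / R ^ n) with hk
  have hkpos : 0 < coneConst n / R ^ n := div_pos (coneConst_pos n) (by positivity)
  have hk0 : k ≠ 0 := by simpa [hk] using hkpos
  have hkt : k ≠ ⊤ := ENNReal.ofReal_ne_top
  have hm : Measurable (fun ω : sphere (0 : EuclideanSpace ℝ (Fin (n + 1))) 1 =>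
      R • (ω : EuclideanSpace ℝ (Fin (n + 1)))) := by fun_prop
  set τ := Measure.map (fun ω : sphere (0 : EuclideanSpace ℝ (Fin (n + 1))) 1 =>
      R • (ω : EuclideanSpace ℝ (Fin (n + 1)))) (volume.toSphere) with hτ
  have main : k⁻¹ • τ ≤ μH[(n : ℝ)] := by
    refine Measure.le_hausdorffMeasure _ _ (ENNReal.ofReal R) (by simpa using hR) ?_
    intro s hs
    have hdt : ediam s ≠ ⊤ := (hs.trans_lt ENNReal.ofReal_lt_top).ne
    rw [Measure.smul_apply, smul_eq_mul, ENNReal.inv_mul_le_iff hk0 hkt, ENNReal.rpow_natCast]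
    refine (measure_mono subset_closure).trans ?_
    rw [hτ, Measure.map_apply hm isClosed_closure.measurableSet]
    rcases Set.eq_empty_or_nonempty ((fun ω : sphere (0 : EuclideanSpace ℝ (Fin (n + 1))) 1 =>
      R • (ω : EuclideanSpace ℝ (Fin (n + 1)))) ⁻¹' closure s) with h | ⟨v, hv⟩
    · rw [h]; simp
    have hsD : (ediam s).toReal ≤ R := ENNReal.toReal_le_of_le_ofReal hR.le hs
    refine (toSphere_le n hn _ (hm isClosed_closure.measurableSet) v ((ediam s).toReal / R)
      (by positivity) (by rw [div_le_one hR]; exact hsD) ?_).trans ?_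
    · intro a ha
      have h1 : edist (R • (a : EuclideanSpace ℝ (Fin (n + 1)))) (R • v) ≤ ediam s := by
        rw [← ediam_closure s]
        exact edist_le_ediam_of_mem ha hv
      have h2 := ENNReal.toReal_mono hdt h1
      rw [← dist_edist, dist_smul₀, Real.norm_eq_abs, abs_of_pos hR] at h2
      rw [le_div_iff₀ hR, mul_comm]
      exact h2
    · conv_rhs => rw [← ENNReal.ofReal_toReal hdt]
      rw [← ENNReal.ofReal_pow ENNReal.toReal_nonneg, hk, ← ENNReal.ofReal_mul hkpos.le]
      apply ENNReal.ofReal_le_ofReal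
      apply le_of_eq
      rw [div_pow]
      ring
  intro s
  have := main s
  rw [Measure.smul_apply, smul_eq_mul, ENNReal.inv_mul_le_iff hk0 hkt] at this
  simpa using this

lemma fiber_le (n : ℕ) (hn : n ≠ 0) (R C t p : ℝ) (hR : 0 < R) (ht : 0 < t)
    (hp : 0 ≤ p) (hpC : p ≤ C) :
    Measure.volumeIoiPow n {r : Set.Ioi (0 : ℝ) | t ≤ R ^ n * p / (r : ℝ) ^ n} ≤
      ENNReal.ofReal (2 ^ (n + 1) / (n + 1) * R ^ (n + 1) * (C / t) ^ ((1 : ℝ) / n) / t) *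
        ENNReal.ofReal p := by
  set b := (p / t) ^ ((1 : ℝ) / n) with hb
  have hq : 0 ≤ p / t := by positivity
  have hb0 : 0 ≤ b := by positivity
  have hbn : b ^ n = p / t := by
    rw [hb, one_div, Real.rpow_inv_natCast_pow hq hn]
  have hbB : b ≤ (C / t) ^ ((1 : ℝ) / n) := by
    apply Real.rpow_le_rpow hq _ (by positivity)
    gcongr
  have hr : ∀ r : Set.Ioi (0 : ℝ), t ≤ R ^ n * p / (r : ℝ) ^ n → (r : ℝ) ≤ R * b := by
    rintro ⟨r, hr⟩ h
    have hr' : 0 < r := hr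
    simp only at h ⊢
    rw [le_div_iff₀ (by positivity)] at h
    rw [← pow_le_pow_iff_left₀ hr'.le (by positivity) hn, mul_pow, hbn, ← mul_div_assoc,
      le_div_iff₀ ht]
    linarith
  rcases hb0.eq_or_lt with h | h
  · have : {r : Set.Ioi (0 : ℝ) | t ≤ R ^ n * p / (r : ℝ) ^ n} = ∅ := by
      ext r
      simp only [Set.mem_ofPred_eq, Set.mem_empty_iff_false, iff_false]
      intro h'
      have h1 := hr r h'
      have h2 : 0 < (r : ℝ) := r.2
      rw [← h] at h1
      linarith
    rw [this]
    simp
  · have ha : 0 < 2 * (R * b) := by positivity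
    have hsub : {r : Set.Ioi (0 : ℝ) | t ≤ R ^ n * p / (r : ℝ) ^ n} ⊆
        Set.Iio (⟨2 * (R * b), ha⟩ : Set.Ioi (0 : ℝ)) := by
      intro r h'
      have h1 := hr r h'
      rw [Set.mem_Iio, ← Subtype.coe_lt_coe]
      simp only
      linarith
    refine (measure_mono hsub).trans ?_
    rw [Measure.volumeIoiPow_apply_Iio, ← ENNReal.ofReal_mul' hp]
    apply ENNReal.ofReal_le_ofReal
    simp only
    calc (2 * (R * b)) ^ (n + 1) / (n + 1)
        = 2 ^ (n + 1) / (n + 1) * R ^ (n + 1) * b * b ^ n := by ring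
      _ = 2 ^ (n + 1) / (n + 1) * R ^ (n + 1) * b * (p / t) := by rw [hbn]
      _ ≤ 2 ^ (n + 1) / (n + 1) * R ^ (n + 1) * (C / t) ^ ((1 : ℝ) / n) * (p / t) := by gcongr
      _ = _ := by ring

lemma vol_le (n : ℕ) (hn : n ≠ 0) (R C M : ℝ) (hR : 0 < R) (hC : 0 < C)
    (φ : EuclideanSpace ℝ (Fin (n + 1)) → ℝ) (hφ : Measurable φ) (h0 : ∀ x, 0 ≤ φ x)
    (hφC : ∀ ω ∈ sphere (0 : EuclideanSpace ℝ (Fin (n + 1))) R, φ ω ≤ C)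
    (hM : (∫ ω in sphere (0 : EuclideanSpace ℝ (Fin (n + 1))) R, φ ω ∂(μH[(n : ℝ)])) = M)
    (t : ℝ) (ht : 0 < t) :
    volume {x : EuclideanSpace ℝ (Fin (n + 1)) |
              0 < ‖x‖ ∧ ‖x‖ ≤ R ∧ t ≤ R ^ n * φ ((R / ‖x‖) • x) / ‖x‖ ^ n} ≤
      ENNReal.ofReal (2 ^ (n + 1) / (n + 1) * R ^ (n + 1) * (C / t) ^ ((1 : ℝ) / n) / t) *
        (ENNReal.ofReal (coneConst n / R ^ n) * ENNReal.ofReal M) := by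
  set S := {x : EuclideanSpace ℝ (Fin (n + 1)) |
              0 < ‖x‖ ∧ ‖x‖ ≤ R ∧ t ≤ R ^ n * φ ((R / ‖x‖) • x) / ‖x‖ ^ n}
  set E' : Set (sphere (0 : EuclideanSpace ℝ (Fin (n + 1))) 1 × Set.Ioi (0 : ℝ)) :=
    {p | t ≤ R ^ n * φ (R • (p.1 : EuclideanSpace ℝ (Fin (n + 1)))) / (p.2 : ℝ) ^ n} with hE'
  have hm : Measurable (fun ω : sphere (0 : EuclideanSpace ℝ (Fin (n + 1))) 1 =>
      R • (ω : EuclideanSpace ℝ (Fin (n + 1)))) := by fun_prop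
  have hE'm : MeasurableSet E' := by
    refine measurableSet_le measurable_const ?_
    exact ((hφ.comp (hm.comp measurable_fst)).const_mul _).div
      ((measurable_subtype_coe.comp measurable_snd).pow_const n)
  have mp := Measure.measurePreserving_homeomorphUnitSphereProd
    (volume : Measure (EuclideanSpace ℝ (Fin (n + 1))))
  rw [finrank_euclideanSpace_fin, Nat.add_sub_cancel] at mp
  have hint : IntegrableOn φ (sphere (0 : EuclideanSpace ℝ (Fin (n + 1))) R) μH[(n : ℝ)] := by
    refine Measure.integrableOn_of_bounded (M := C) (hausdorff_sphere_lt_top n R hR).ne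
      hφ.aestronglyMeasurable ?_
    filter_upwards [ae_restrict_mem isClosed_sphere.measurableSet] with x hx
    rw [Real.norm_eq_abs, abs_of_nonneg (h0 x)]
    exact hφC x hx
  have step1 : volume S ≤ (volume.toSphere.prod (Measure.volumeIoiPow n)) E' := by
    rw [← mp.measure_preimage hE'm.nullMeasurableSet,
      comap_subtype_coe_apply (measurableSet_singleton _).compl]
    apply measure_mono
    intro x hx
    have hx0 : x ≠ 0 := norm_pos_iff.1 hx.1
    refine ⟨⟨x, hx0⟩, ?_, rfl⟩
    have := hx.2.2
    simp only [hE', Set.mem_preimage, Set.mem_ofPred_eq, homeomorphUnitSphereProd_apply_fst_coe,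
      homeomorphUnitSphereProd_apply_snd_coe, smul_smul]
    rwa [← div_eq_mul_inv]
  refine step1.trans ?_
  rw [Measure.prod_apply hE'm]
  have step2 : ∀ ω : sphere (0 : EuclideanSpace ℝ (Fin (n + 1))) 1,
      Measure.volumeIoiPow n (Prod.mk ω ⁻¹' E') ≤
      ENNReal.ofReal (2 ^ (n + 1) / (n + 1) * R ^ (n + 1) * (C / t) ^ ((1 : ℝ) / n) / t) *
        ENNReal.ofReal (φ (R • (ω : EuclideanSpace ℝ (Fin (n + 1))))) := by
    intro ω
    have hω : R • (ω : EuclideanSpace ℝ (Fin (n + 1))) ∈ sphere 0 R := by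
      simp [norm_smul, abs_of_pos hR]
    have hf := fiber_le n hn R C t (φ (R • (ω : EuclideanSpace ℝ (Fin (n + 1))))) hR ht (h0 _)
      (hφC _ hω)
    refine le_trans (measure_mono ?_) hf
    intro r hr
    exact hr
  generalize ENNReal.ofReal (2 ^ (n + 1) / (n + 1) * R ^ (n + 1) * (C / t) ^ ((1 : ℝ) / n) / t)
    = G at step2 ⊢
  have hfm : Measurable (fun ω : sphere (0 : EuclideanSpace ℝ (Fin (n + 1))) 1 =>
      ENNReal.ofReal (φ (R • (ω : EuclideanSpace ℝ (Fin (n + 1)))))) :=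
    (hφ.comp hm).ennreal_ofReal
  refine (lintegral_mono step2).trans ?_
  rw [lintegral_const_mul G hfm]
  refine mul_le_mul_right ?_ G
  have e1 : ∫⁻ ω : sphere (0 : EuclideanSpace ℝ (Fin (n + 1))) 1,
      ENNReal.ofReal (φ (R • (ω : EuclideanSpace ℝ (Fin (n + 1))))) ∂(volume.toSphere) =
      ∫⁻ x, ENNReal.ofReal (φ x) ∂(Measure.map
        (fun ω : sphere (0 : EuclideanSpace ℝ (Fin (n + 1))) 1 =>
      R • (ω : EuclideanSpace ℝ (Fin (n + 1)))) (volume.toSphere)) :=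
    (lintegral_map hφ.ennreal_ofReal hm).symm
  have hres : (Measure.map
        (fun ω : sphere (0 : EuclideanSpace ℝ (Fin (n + 1))) 1 =>
      R • (ω : EuclideanSpace ℝ (Fin (n + 1)))) (volume.toSphere)).restrict (sphere 0 R) =
      (Measure.map
        (fun ω : sphere (0 : EuclideanSpace ℝ (Fin (n + 1))) 1 =>
      R • (ω : EuclideanSpace ℝ (Fin (n + 1)))) (volume.toSphere)) := by
    apply Measure.restrict_eq_self_of_ae_mem
    refine (ae_map_iff (p := fun x => x ∈ sphere (0 : EuclideanSpace ℝ (Fin (n + 1))) R)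
      hm.aemeasurable isClosed_sphere.measurableSet).2 ?_
    refine Filter.Eventually.of_forall fun ω => ?_
    simp [norm_smul, abs_of_pos hR]
  rw [e1, ← hres, ← hM, ofReal_integral_eq_lintegral_ofReal hint
    (Filter.Eventually.of_forall h0), ← smul_eq_mul, ← lintegral_smul_measure,
    ← Measure.restrict_smul]
  exact lintegral_mono' (Measure.restrict_mono le_rfl (map_toSphere_le n hn R hR)) le_rfl

lemma first_bound (n : ℕ) (hn : n ≠ 0) (R C M : ℝ) (hR : 0 < R) (hC : 0 < C) (hM0 : 0 ≤ M)
    (φ : EuclideanSpace ℝ (Fin (n + 1)) → ℝ) (hφ : Measurable φ) (h0 : ∀ x, 0 ≤ φ x)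
    (hφC : ∀ ω ∈ sphere (0 : EuclideanSpace ℝ (Fin (n + 1))) R, φ ω ≤ C)
    (hM : (∫ ω in sphere (0 : EuclideanSpace ℝ (Fin (n + 1))) R, φ ω ∂(μH[(n : ℝ)])) = M)
    (t : ℝ) (ht : 0 < t) :
    volume {x : EuclideanSpace ℝ (Fin (n + 1)) |
              0 < ‖x‖ ∧ ‖x‖ ≤ R ∧ t ≤ R ^ n * φ ((R / ‖x‖) • x) / ‖x‖ ^ n} ≤
      ENNReal.ofReal (2 ^ (n + 1) / (n + 1) * coneConst n * R * C ^ ((1 : ℝ) / n) * M *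
        t ^ (-((n : ℝ) + 1) / n)) := by
  refine (vol_le n hn R C M hR hC φ hφ h0 hφC hM t ht).trans ?_
  have hc := coneConst_pos n
  have hn' : (n : ℝ) ≠ 0 := by exact_mod_cast hn
  rw [← ENNReal.ofReal_mul (by positivity), ← ENNReal.ofReal_mul (by positivity)]
  apply ENNReal.ofReal_le_ofReal
  apply le_of_eq
  have e : t ^ (-((n : ℝ) + 1) / n) = (t ^ ((1 : ℝ) / n))⁻¹ * t⁻¹ := by
    rw [← Real.rpow_neg ht.le, ← Real.rpow_neg_one t, ← Real.rpow_add ht]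
    congr 1
    field_simp
    ring
  rw [e, Real.div_rpow hC.le ht.le]
  field_simp
  ring

theorem stmt11 (d : ℕ) (hd : 2 ≤ d) :
    ∃ c c' : ℝ, 0 < c ∧ 0 < c' ∧
      ∀ (R C M : ℝ), 0 < R → 0 < C → 0 ≤ M →
      ∀ (φ : EuclideanSpace ℝ (Fin d) → ℝ), Measurable φ →
        (∀ x, 0 ≤ φ x) →
        (∀ ω ∈ Metric.sphere (0 : EuclideanSpace ℝ (Fin d)) R, φ ω ≤ C) →
        (∫ ω in Metric.sphere (0 : EuclideanSpace ℝ (Fin d)) R,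
            φ ω ∂(μH[(d : ℝ) - 1])) = M →
        (∀ t : ℝ, 0 < t →
          volume {x : EuclideanSpace ℝ (Fin d) |
              0 < ‖x‖ ∧ ‖x‖ ≤ R ∧ t ≤ R ^ (d - 1) * φ ((R / ‖x‖) • x) / ‖x‖ ^ (d - 1)} ≤
            ENNReal.ofReal
              (c * R * C ^ ((1 : ℝ) / ((d : ℝ) - 1)) * M *
                t ^ (-(d : ℝ) / ((d : ℝ) - 1)))) ∧
        (∀ t : ℝ, 0 < t →
          t * (volume {x : EuclideanSpace ℝ (Fin d) |
              0 < ‖x‖ ∧ ‖x‖ ≤ R ∧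
                t ≤ R ^ (d - 1) * φ ((R / ‖x‖) • x) / ‖x‖ ^ (d - 1)}).toReal ^
                (((d : ℝ) - 1) / d) ≤
            c' * (R * C ^ ((1 : ℝ) / ((d : ℝ) - 1)) * M) ^ (((d : ℝ) - 1) / d)) := by
  obtain ⟨n, rfl⟩ : ∃ n, d = n + 1 := ⟨d - 1, by omega⟩
  have hn : n ≠ 0 := by omega
  have hn' : (n : ℝ) ≠ 0 := by exact_mod_cast hn
  have hc := coneConst_pos n
  have hn1 : (n : ℝ) + 1 ≠ 0 := by positivity
  have e1 : ((n + 1 : ℕ) : ℝ) - 1 = n := by push_cast; ring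
  have e2 : ((n + 1 : ℕ) : ℝ) = n + 1 := by push_cast; ring
  rw [e1, e2, Nat.add_sub_cancel]
  set c := 2 ^ (n + 1) / (n + 1) * coneConst n with hcdef
  have hcpos : 0 < c := by positivity
  refine ⟨c, c ^ ((n : ℝ) / (n + 1)), hcpos, by positivity, ?_⟩
  intro R C M hR hC hM0 φ hφ h0 hφC hM
  have first := first_bound n hn R C M hR hC hM0 φ hφ h0 hφC hM
  refine ⟨first, fun t ht => ?_⟩
  have h := ENNReal.toReal_le_of_le_ofReal (by positivity) (first t ht)
  calc _ ≤ t * (c * R * C ^ ((1 : ℝ) / n) * M * t ^ (-((n : ℝ) + 1) / n)) ^ ((n : ℝ) / (n + 1)) := by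
        gcongr
    _ = t * ((c * (R * C ^ ((1 : ℝ) / n) * M)) ^ ((n : ℝ) / (n + 1)) * t⁻¹) := by
        have e3 : c * R * C ^ ((1 : ℝ) / n) * M * t ^ (-((n : ℝ) + 1) / n) =
          (c * (R * C ^ ((1 : ℝ) / n) * M)) * t ^ (-((n : ℝ) + 1) / n) := by ring
        rw [e3, Real.mul_rpow (by positivity) (by positivity), ← Real.rpow_mul ht.le,
          ← Real.rpow_neg_one t]
        congr 3
        field_simp
    _ = (c * (R * C ^ ((1 : ℝ) / n) * M)) ^ ((n : ℝ) / (n + 1)) := by field_simp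
    _ = _ := by rw [Real.mul_rpow (by positivity) (by positivity)]
end
end
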